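/- arXiv:2503.15585 — 3 statements merged into one kernel-verified Lean document; each statement's English description precedes it below -/
import Mathlib

section
/- Let C be a category with an (E,M)-factorization system and F : C → C an endofunctor. If h : (C, c, i_C) → (D, d, i_D) is a pointed coalgebra homomorphism whose underlying morphism belongs to M, and both (C, c, i_C) and (D, d, i_D) are M-reachable, then h is an isomorphism. -/
open CategoryTheory Limits

universe v u

variable {C : Type u} [Category.{v} C]

/-- A pointed `F`-coalgebra: an object `X`, a structure map `X ⟶ F X`,
and a point `I ⟶ X`. -/
structure PtCoalg (F : C ⥤ C) (I : C) where
  X : C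
  str : X ⟶ F.obj X
  pt : I ⟶ X

/-- A pointed coalgebra homomorphism: a morphism commuting with the structure maps
and preserving the point. -/
structure PtHom {F : C ⥤ C} {I : C} (A B : PtCoalg F I) where
  f : A.X ⟶ B.X
  comm : f ≫ B.str = A.str ≫ F.map f
  point : A.pt ≫ f = B.pt

/-- `h` is an isomorphism of pointed coalgebras: it has a two-sided inverse that is itself
a pointed coalgebra homomorphism. -/
def PtHom.IsIsoHom {F : C ⥤ C} {I : C} {A B : PtCoalg F I} (h : PtHom A B) : Prop :=
  ∃ s : PtHom B A, h.f ≫ s.f = 𝟙 A.X ∧ s.f ≫ h.f = 𝟙 B.X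

/-- A pointed coalgebra `B` is `M`-reachable if every pointed coalgebra homomorphism
into `B` whose underlying morphism is in `M` is a split epimorphism in the category of
pointed coalgebras. -/
def IsReachable {F : C ⥤ C} {I : C} (M : MorphismProperty C) (B : PtCoalg F I) : Prop :=
  ∀ (A : PtCoalg F I) (h : PtHom A B), M h.f → ∃ s : PtHom B A, s.f ≫ h.f = 𝟙 B.X

/-- A pointed coalgebra `B` is a tree if every pointed coalgebra homomorphism into `B`
is a split epimorphism in the category of pointed coalgebras. -/
def IsTree {F : C ⥤ C} {I : C} (B : PtCoalg F I) : Prop :=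
  ∀ (A : PtCoalg F I) (h : PtHom A B), ∃ s : PtHom B A, s.f ≫ h.f = 𝟙 B.X

/-- An (E,M)-factorization system on a category `C`: classes `E` and `M` of morphisms,
each closed under composition and containing all isomorphisms, such that every morphism
factors as an `E`-morphism followed by an `M`-morphism, and every commutative square
with an `E`-morphism on the left and an `M`-morphism on the right has a unique diagonal. -/
structure FactorizationSystem (C : Type u) [Category.{v} C] where
  E : MorphismProperty C
  M : MorphismProperty C
  E_comp : ∀ {X Y Z : C} (f : X ⟶ Y) (g : Y ⟶ Z), E f → E g → E (f ≫ g)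
  M_comp : ∀ {X Y Z : C} (f : X ⟶ Y) (g : Y ⟶ Z), M f → M g → M (f ≫ g)
  E_iso : ∀ {X Y : C} (f : X ⟶ Y), IsIso f → E f
  M_iso : ∀ {X Y : C} (f : X ⟶ Y), IsIso f → M f
  factor : ∀ {X Y : C} (f : X ⟶ Y), ∃ (Z : C) (e : X ⟶ Z) (m : Z ⟶ Y), E e ∧ M m ∧ e ≫ m = f
  diagonal : ∀ {A B X Y : C} (e : A ⟶ B) (m : X ⟶ Y) (f : A ⟶ X) (g : B ⟶ Y),
    E e → M m → e ≫ g = f ≫ m → ∃! d : B ⟶ X, e ≫ d = f ∧ d ≫ m = g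

/-- The right class of a factorization system is left cancellable: if `f ≫ g` and `g` are
in `M`, then so is `f`. -/
theorem FactorizationSystem.M_of_comp (FS : FactorizationSystem C) {X Y Z : C}
    (f : X ⟶ Y) (g : Y ⟶ Z) (hg : FS.M g) (hfg : FS.M (f ≫ g)) : FS.M f := by
  obtain ⟨W, e, m, he, hm, rfl⟩ := FS.factor f
  obtain ⟨d, ⟨hed, hd⟩, -⟩ := FS.diagonal e ((e ≫ m) ≫ g) (𝟙 X) (m ≫ g) he hfg (by simp)
  have hde : d ≫ e = 𝟙 W :=
    (FS.diagonal e (m ≫ g) e (m ≫ g) he (FS.M_comp m g hm hg) rfl).unique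
      ⟨by simp [reassoc_of% hed], by simpa using hd⟩ ⟨by simp, by simp⟩
  exact FS.M_comp e m (FS.M_iso e ⟨d, hed, hde⟩) hm

/-- Given an (E,M)-factorization system, any pointed coalgebra homomorphism lying in `M`
between `M`-reachable pointed coalgebras is an isomorphism. -/
theorem hom_between_reachable_isIso
    {F : C ⥤ C} {I : C} (FS : FactorizationSystem C)
    {A B : PtCoalg F I} (h : PtHom A B) (hMem : FS.M h.f)
    (hA : IsReachable FS.M A) (hB : IsReachable FS.M B) :
    h.IsIsoHom := by
  obtain ⟨s, hs⟩ := hB A h hMem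
  have hsM : FS.M s.f :=
    FS.M_of_comp s.f h.f hMem (hs ▸ FS.M_iso (𝟙 B.X) inferInstance)
  obtain ⟨t, ht⟩ := hA B s hsM
  have hth : t.f = h.f := by
    rw [← Category.comp_id t.f, ← hs, reassoc_of% ht]
  exact ⟨s, hth ▸ ht, hs⟩
end

section
/- Let C be a category, F : C → C an endofunctor, I an object of C, and M a class of morphisms of C. Suppose every pointed F-coalgebra admits an M-reachable subcoalgebra, i.e. a pointed coalgebra homomorphism into it whose underlying morphism is in M and whose domain is an M-reachable pointed coalgebra. Then every M-reachably unfolded pointed F-coalgebra is a tree (and in particular is M-reachable). -/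
open CategoryTheory Limits

universe v u

variable {C : Type u} [Category.{v} C]

/-- A pointed coalgebra `B` is `M`-reachably unfolded if every pointed coalgebra
homomorphism into `B` from an `M`-reachable pointed coalgebra is an isomorphism. -/
def IsReachablyUnfolded {F : C ⥤ C} {I : C} (M : MorphismProperty C)
    (B : PtCoalg F I) : Prop :=
  ∀ (R : PtCoalg F I) (h : PtHom R B), IsReachable M R → h.IsIsoHom

/-- Composition of pointed coalgebra homomorphisms. -/
def PtHom.comp {F : C ⥤ C} {I : C} {A B D : PtCoalg F I} (g : PtHom A B) (h : PtHom B D) :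
    PtHom A D where
  f := g.f ≫ h.f
  comm := by
    rw [Category.assoc, h.comm, ← Category.assoc, g.comm, Category.assoc, F.map_comp]
  point := by rw [← Category.assoc, g.point, h.point]

/-- A tree is `M`-reachable for every class `M` of morphisms. -/
theorem IsTree.isReachable {F : C ⥤ C} {I : C} {B : PtCoalg F I} (hB : IsTree B)
    (M : MorphismProperty C) : IsReachable M B :=
  fun A h _ => hB A h

/-- If every pointed coalgebra admits an `M`-reachable subcoalgebra (a pointed coalgebra
homomorphism into it whose underlying morphism is in `M` and whose domain is
`M`-reachable), then every `M`-reachably unfolded pointed coalgebra is a tree, and in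
particular is `M`-reachable. -/
theorem reachably_unfolded_is_tree
    {F : C ⥤ C} {I : C} (M : MorphismProperty C)
    (hsub : ∀ (B : PtCoalg F I), ∃ (R : PtCoalg F I) (h : PtHom R B),
      M h.f ∧ IsReachable M R)
    (B : PtCoalg F I) (hB : IsReachablyUnfolded M B) :
    IsTree B ∧ IsReachable M B := by
  have tree : IsTree B := fun A h => by
    obtain ⟨R, m, -, hR⟩ := hsub A
    obtain ⟨s, -, hs⟩ := hB R (m.comp h) hR
    exact ⟨s.comp m, (Category.assoc _ _ _).trans hs⟩
  exact ⟨tree, tree.isReachable M⟩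
end

section
/- Fix an alphabet A and a pointed partial deterministic automaton (C, o, δ, q0). The map P → C sending a word w ∈ P to the unique q ∈ C with δ*(q0)(w) = inl(q) is a pointed coalgebra homomorphism from the coalgebra of defined inputs (P, ō, δ̄, ε) to (C, o, δ, q0); since (P, ō, δ̄, ε) is a tree, this homomorphism is a tree unravelling of (C, o, δ, q0). -/
universe u v w

variable {A : Type u}

/-- The extension of a partial transition map `δ` to words: `deltaStar δ q w` is the
state reached from `q` by reading the word `w`, if defined. -/
def deltaStar {C : Type v} (δ : C → A → Option C) (q : C) (w : List A) : Option C :=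
  w.foldl (fun s a => s.bind (fun q' => δ q' a)) (some q)

/-- The set of defined inputs of a pointed partial deterministic automaton: the words on
which the extended transition map from the initial state is defined. -/
def Defined {C : Type v} (δ : C → A → Option C) (q0 : C) : Type u :=
  {w : List A // (deltaStar δ q0 w).isSome}

/-- The output function of the coalgebra of defined inputs. -/
def definedOut {C : Type v} (o : C → Bool) (δ : C → A → Option C) (q0 : C)
    (w : Defined δ q0) : Bool :=
  o ((deltaStar δ q0 w.1).get w.2)

/-- The transition function of the coalgebra of defined inputs. -/
def definedTrans {C : Type v} (δ : C → A → Option C) (q0 : C)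
    (w : Defined δ q0) (a : A) : Option (Defined δ q0) :=
  if h : (deltaStar δ q0 (w.1 ++ [a])).isSome then some ⟨w.1 ++ [a], h⟩ else none

/-- The point of the coalgebra of defined inputs: the empty word. -/
def definedPt {C : Type v} (δ : C → A → Option C) (q0 : C) : Defined δ q0 :=
  ⟨[], rfl⟩

/-- The map sending a defined input word to the state it reaches. -/
def definedRun {C : Type v} (δ : C → A → Option C) (q0 : C) (w : Defined δ q0) : C :=
  (deltaStar δ q0 w.1).get w.2

theorem deltaStar_append_singleton {C : Type v} (δ : C → A → Option C) (q : C) (w : List A)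
    (a : A) : deltaStar δ q (w ++ [a]) = (deltaStar δ q w).bind fun q' => δ q' a := by
  simp [deltaStar]

theorem deltaStar_eq_some_definedRun {C : Type v} (δ : C → A → Option C) (q0 : C)
    (w : Defined δ q0) : deltaStar δ q0 w.1 = some (definedRun δ q0 w) := by
  simp [definedRun]

theorem map_definedRun_definedTrans {C : Type v} (δ : C → A → Option C) (q0 : C)
    (w : Defined δ q0) (a : A) :
    Option.map (definedRun δ q0) (definedTrans δ q0 w a) = δ (definedRun δ q0 w) a := by
  have key : deltaStar δ q0 (w.1 ++ [a]) = δ (definedRun δ q0 w) a := by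
    rw [deltaStar_append_singleton, deltaStar_eq_some_definedRun, Option.bind_some]
  rw [← key, definedTrans]
  split
  · exact Option.some_get _
  · simp_all

/-- A transition-preserving map into the coalgebra of defined inputs lifts every defined input
word to a run of its domain, ending over that word. -/
theorem exists_deltaStar_eq_some_of_hom {C : Type v} {δ : C → A → Option C} {q0 : C}
    {T : Type w} {δT : T → A → Option T} {t0 : T} {h : T → Defined δ q0}
    (htrans : ∀ x a, definedTrans δ q0 (h x) a = Option.map h (δT x a))
    (hpt : h t0 = definedPt δ q0) (w : List A) (hw : (deltaStar δ q0 w).isSome) :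
    ∃ t, deltaStar δT t0 w = some t ∧ h t = ⟨w, hw⟩ := by
  induction w using List.reverseRecOn with
  | nil => exact ⟨t0, rfl, hpt⟩
  | append_singleton w a ih =>
    have hw' : (deltaStar δ q0 w).isSome := by
      rw [deltaStar_append_singleton] at hw
      exact Option.isSome_of_isSome_bind hw
    obtain ⟨t, ht, hht⟩ := ih hw'
    have hstep : definedTrans δ q0 ⟨w, hw'⟩ a = some ⟨w ++ [a], hw⟩ := dif_pos hw
    rw [← hht, htrans] at hstep
    obtain ⟨t', ht', hht'⟩ := Option.map_eq_some_iff.1 hstep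
    exact ⟨t', by rw [deltaStar_append_singleton, ht, Option.bind_some, ht'], hht'⟩

/-- The map sending each defined input word to the state it reaches is a pointed
coalgebra homomorphism from the coalgebra of defined inputs to the automaton; since the
coalgebra of defined inputs is a tree, this homomorphism is a tree unravelling of the
automaton. -/
theorem definedRun_is_tree_unravelling
    {C : Type v} (o : C → Bool) (δ : C → A → Option C) (q0 : C) :
    (∀ w, o (definedRun δ q0 w) = definedOut o δ q0 w) ∧
    (∀ (w : Defined δ q0) (a : A),
      δ (definedRun δ q0 w) a = Option.map (definedRun δ q0) (definedTrans δ q0 w a)) ∧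
    definedRun δ q0 (definedPt δ q0) = q0 ∧
    (∀ {T : Type w} (oT : T → Bool) (δT : T → A → Option T) (t0 : T)
        (h : T → Defined δ q0),
      (∀ x, definedOut o δ q0 (h x) = oT x) →
      (∀ x a, definedTrans δ q0 (h x) a = Option.map h (δT x a)) →
      h t0 = definedPt δ q0 →
      ∃ s : Defined δ q0 → T,
        (∀ w, oT (s w) = definedOut o δ q0 w) ∧
        (∀ w a, δT (s w) a = Option.map s (definedTrans δ q0 w a)) ∧
        s (definedPt δ q0) = t0 ∧
        ∀ w, h (s w) = w) := by
  refine ⟨fun _ => rfl, fun w a => (map_definedRun_definedTrans δ q0 w a).symm, rfl, ?_⟩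
  intro T oT δT t0 h hout htrans hpt
  choose s hrun hsec using
    fun w : Defined δ q0 => exists_deltaStar_eq_some_of_hom htrans hpt w.1 w.2
  refine ⟨s, fun w => ?_, fun w a => ?_, ?_, hsec⟩
  · rw [← hout, hsec]
    rfl
  · have hstep := htrans (s w) a
    rw [hsec] at hstep
    change definedTrans δ q0 w a = _ at hstep
    cases htr : definedTrans δ q0 w a with
    | none => simpa [htr] using hstep.symm
    | some w' =>
      have hw' : w'.1 = w.1 ++ [a] := by
        rw [definedTrans] at htr
        split at htr
        · rw [← Option.some.inj htr]
        · cases htr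
      have hlast := hrun w'
      rw [hw', deltaStar_append_singleton, hrun, Option.bind_some] at hlast
      exact hlast
  · exact (Option.some.inj (hrun (definedPt δ q0))).symm
end
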